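/- arXiv:cs/0201001 — 2 statements merged into one kernel-verified Lean document; each statement's English description precedes it below -/
import Mathlib

section
/- There exists a constant C > 0 such that for every n ≥ 1, every quadratic computation of n×n matrix product over GF(2) has length m ≥ 3n² − C·n^(5/3). In particular, the number of product gates in any quadratic circuit computing the product of two n×n matrices over GF(2) is at least 3n² − O(n^(5/3)). -/
open MvPolynomial in
/-- A polynomial over `GF(2)` which does not vanish identically as a function is nonzero at a point
with at most `totalDegree` nonzero coordinates. -/
lemma MvPolynomial.exists_eval_ne_zero_card_support_le {σ : Type*} [Fintype σ] [DecidableEq σ]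
    (p : MvPolynomial σ (ZMod 2)) (h : ∃ z, eval z p ≠ 0) :
    ∃ z, eval z p ≠ 0 ∧ (Finset.univ.filter fun i => z i ≠ 0).card ≤ p.totalDegree := by
  obtain ⟨z₀, hz₀⟩ := h
  obtain ⟨z, hz, hmin⟩ := Finset.exists_min_image
    (Finset.univ.filter fun z : σ → ZMod 2 => eval z p ≠ 0)
    (fun z => (Finset.univ.filter fun i => z i ≠ 0).card) ⟨z₀, by simpa using hz₀⟩
  replace hz : eval z p ≠ 0 := (Finset.mem_filter.1 hz).2
  refine ⟨z, hz, ?_⟩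
  by_contra! hlt
  have hpart := Finset.card_filter_add_card_filter_not (s := Finset.univ) (fun i : σ => z i ≠ 0)
  set U := Finset.univ.filter fun i => ¬ z i ≠ 0 with hU
  set f : MvPolynomial σ (ZMod 2) := p * ∏ i ∈ U, (1 - X i) with hf
  have hfdeg : f.totalDegree < (Fintype.card (ZMod 2) - 1) * Fintype.card σ := by
    have h1 : (∏ i ∈ U, (1 - X i : MvPolynomial σ (ZMod 2))).totalDegree ≤ U.card := by
      refine (totalDegree_finsetProd _ _).trans ?_
      rw [Finset.card_eq_sum_ones]
      refine Finset.sum_le_sum fun i _ => (totalDegree_sub _ _).trans ?_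
      simp
    have h2 := totalDegree_mul p (∏ i ∈ U, (1 - X i : MvPolynomial σ (ZMod 2)))
    rw [ZMod.card, ← Finset.card_univ, hf]
    omega
  have hsum := sum_eval_eq_zero f hfdeg
  rw [Finset.sum_eq_single z] at hsum
  · have h1 : ∏ i ∈ U, (1 - z i) = 1 :=
      Finset.prod_eq_one fun i hi => by
        have : z i = 0 := by simpa [hU] using hi
        simp [this]
    simp [hf, map_prod, h1, hz] at hsum
  · intro x _ hx
    by_contra hne
    have hne' : eval x p ≠ 0 ∧ ∏ i ∈ U, (1 - x i) ≠ 0 := by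
      simpa [hf, map_prod] using hne
    obtain ⟨hpx, hprod⟩ := hne'
    rw [Finset.prod_ne_zero_iff] at hprod
    have hbin : ∀ a : ZMod 2, 1 - a ≠ 0 → a = 0 := by decide
    have hbin' : ∀ a b : ZMod 2, a ≠ 0 → b ≠ 0 → a = b := by decide
    have hzero : ∀ i, z i = 0 → x i = 0 := fun i hi => hbin _ (hprod i (by simp [hU, hi]))
    have hsub : (Finset.univ.filter fun i => x i ≠ 0) ⊆ Finset.univ.filter fun i => z i ≠ 0 := by
      intro i hi
      simp only [Finset.mem_filter, Finset.mem_univ, true_and] at hi ⊢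
      exact fun h => hi (hzero i h)
    have heq := Finset.eq_of_subset_of_card_le hsub (hmin x (by simpa using hpx))
    apply hx
    funext i
    by_cases hi : z i = 0
    · rw [hi, hzero i hi]
    · have : i ∈ Finset.univ.filter fun i => x i ≠ 0 := by rw [heq]; simpa using hi
      exact hbin' _ _ (by simpa using this) hi
  · simp

lemma MvPolynomial.totalDegree_det_le {σ R n : Type*} [CommRing R] [Fintype n] [DecidableEq n]
    (M : Matrix n n (MvPolynomial σ R)) (h : ∀ i j, (M i j).totalDegree ≤ 1) :
    M.det.totalDegree ≤ Fintype.card n := by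
  rw [Matrix.det_apply]
  refine totalDegree_finsetSum_le fun τ _ => (totalDegree_smul_le _ _).trans ?_
  refine (totalDegree_finsetProd _ _).trans ?_
  rw [← Finset.card_univ, Finset.card_eq_sum_ones]
  exact Finset.sum_le_sum fun i _ => h _ _

/-- For `t ≤ n` there is a `t`-dimensional space of `n × n` matrices over `GF(2)` all of whose
nonzero elements are invertible. -/
lemma exists_family_det_ne_zero {n t : ℕ} (hn : n ≠ 0) (ht : t ≤ n) :
    ∃ A : Fin t → Matrix (Fin n) (Fin n) (ZMod 2),
      ∀ c : Fin t → ZMod 2, c ≠ 0 → (∑ j, c j • A j).det ≠ 0 := by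
  have : Fact (Nat.Prime 2) := ⟨Nat.prime_two⟩
  let b : Module.Basis (Fin n) (ZMod 2) (GaloisField 2 n) :=
    Module.finBasisOfFinrankEq _ _ (GaloisField.finrank 2 hn)
  have hli : LinearIndependent (ZMod 2) fun j : Fin t => b (Fin.castLE ht j) :=
    b.linearIndependent.comp _ (Fin.castLE_injective ht)
  refine ⟨fun j => Algebra.leftMulMatrix b (b (Fin.castLE ht j)), fun c hc => ?_⟩
  have hsum : ∑ j, c j • Algebra.leftMulMatrix b (b (Fin.castLE ht j)) =
      Algebra.leftMulMatrix b (∑ j, c j • b (Fin.castLE ht j)) := by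
    simp only [map_sum, map_smul]
  rw [hsum]
  have hne : ∑ j, c j • b (Fin.castLE ht j) ≠ 0 := fun h =>
    hc (funext (Fintype.linearIndependent_iff.1 hli c h))
  exact (((Matrix.isUnit_iff_isUnit_det _).1 ((isUnit_iff_ne_zero.2 hne).map _))).ne_zero

open MvPolynomial in
/-- With respect to any basis of the space of `n × n` matrices over `GF(2)`, some `t`-dimensional
space whose nonzero elements are all invertible is supported on at most `2 ^ t * n` basis
elements. -/
lemma exists_sparse_family_det_ne_zero {n t : ℕ} (hn : n ≠ 0) (ht : t ≤ n) {ι : Type*} [Fintype ι]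
    [DecidableEq ι] (b : Module.Basis ι (ZMod 2) (Matrix (Fin n) (Fin n) (ZMod 2))) :
    ∃ (S : Finset ι) (A : Fin t → Matrix (Fin n) (Fin n) (ZMod 2)), S.card ≤ 2 ^ t * n ∧
      (∀ c : Fin t → ZMod 2, c ≠ 0 → (∑ j, c j • A j).det ≠ 0) ∧
      ∀ j, ∀ i ∉ S, b.repr (A j) i = 0 := by
  let G (c : Fin t → ZMod 2) : Matrix (Fin n) (Fin n) (MvPolynomial (Fin t × ι) (ZMod 2)) :=
    Matrix.of fun r s => ∑ j, ∑ i, C (c j * b i r s) * X (j, i)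
  let p : MvPolynomial (Fin t × ι) (ZMod 2) :=
    ∏ c ∈ Finset.univ.filter (fun c : Fin t → ZMod 2 => c ≠ 0), (G c).det
  let A (z : Fin t × ι → ZMod 2) (j : Fin t) : Matrix (Fin n) (Fin n) (ZMod 2) :=
    ∑ i, z (j, i) • b i
  have heval (z : Fin t × ι → ZMod 2) (c : Fin t → ZMod 2) :
      eval z (G c).det = (∑ j, c j • A z j).det := by
    rw [RingHom.map_det]
    congr 1
    ext r s
    simp only [G, A, RingHom.mapMatrix_apply, Matrix.map_apply, Matrix.of_apply, map_sum, map_mul,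
      eval_C, eval_X, Matrix.sum_apply, Matrix.smul_apply, smul_eq_mul, Finset.mul_sum]
    exact Finset.sum_congr rfl fun j _ => Finset.sum_congr rfl fun i _ => by ring
  have hp (z : Fin t × ι → ZMod 2) :
      eval z p ≠ 0 ↔ ∀ c : Fin t → ZMod 2, c ≠ 0 → (∑ j, c j • A z j).det ≠ 0 := by
    simp only [p, map_prod, Finset.prod_ne_zero_iff, heval, Finset.mem_filter, Finset.mem_univ,
      true_and]
  have hdeg : p.totalDegree ≤ 2 ^ t * n := by
    have hdet (c : Fin t → ZMod 2) : (G c).det.totalDegree ≤ n := by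
      refine (totalDegree_det_le _ fun r s => ?_).trans (Fintype.card_fin n).le
      simp only [G, Matrix.of_apply]
      refine totalDegree_finsetSum_le fun j _ => ?_
      refine totalDegree_finsetSum_le fun i _ => ?_
      have hmul := totalDegree_mul (C (c j * b i r s)) (X (j, i) : MvPolynomial _ (ZMod 2))
      rwa [totalDegree_C, totalDegree_X, zero_add] at hmul
    refine (totalDegree_finsetProd _ _).trans ((Finset.sum_le_card_nsmul _ _ n fun c _ =>
      hdet c).trans ?_)
    rw [smul_eq_mul]
    exact Nat.mul_le_mul_right _ ((Finset.card_le_univ _).trans (by simp))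
  obtain ⟨z, hz, hcard⟩ := exists_eval_ne_zero_card_support_le p (by
    obtain ⟨A₀, hA₀⟩ := exists_family_det_ne_zero hn ht
    refine ⟨fun ji => b.repr (A₀ ji.1) ji.2, (hp _).2 ?_⟩
    simpa only [A, b.sum_repr] using hA₀)
  refine ⟨(Finset.univ.filter fun ji => z ji ≠ 0).image Prod.snd, A z,
    Finset.card_image_le.trans (hcard.trans hdeg), (hp z).1 hz, fun j i hi => ?_⟩
  have hrepr : b.repr (A z j) i = z (j, i) := by
    simp only [A]
    rw [b.repr_sum_self fun i => z (j, i)]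
  rw [hrepr]
  by_contra h
  exact hi (Finset.mem_image.2 ⟨(j, i), by simpa using h, rfl⟩)

/-- A linear form on `GF(2)^t` is nonzero on at most half of the points. -/
lemma two_mul_card_ne_zero_le {t : ℕ} (f : (Fin t → ZMod 2) →ₗ[ZMod 2] ZMod 2) :
    2 * (Finset.univ.filter fun c => f c ≠ 0).card ≤ 2 ^ t := by
  by_cases h : ∃ c₀, f c₀ ≠ 0
  · obtain ⟨c₀, hc₀⟩ := h
    have hle : (Finset.univ.filter fun c => f c ≠ 0).card ≤
        (Finset.univ.filter fun c => ¬ f c ≠ 0).card := by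
      refine Finset.card_le_card_of_injOn (· + c₀) (fun c hc => ?_) (add_left_injective c₀).injOn
      have hbin : ∀ a b : ZMod 2, a ≠ 0 → b ≠ 0 → a + b = 0 := by decide
      simp only [Finset.coe_filter, Finset.mem_univ, true_and, Set.mem_ofPred_eq] at hc ⊢
      simpa using hbin _ _ hc hc₀
    have hpart := Finset.card_filter_add_card_filter_not (s := Finset.univ)
      (fun c : Fin t → ZMod 2 => f c ≠ 0)
    have hcard : (Finset.univ : Finset (Fin t → ZMod 2)).card = 2 ^ t := by simp
    omega
  · push Not at h
    simp [h]

universe u in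
/-- Among finitely many linear forms with trivial common kernel one can choose forms whose values
are the coordinates with respect to a basis. -/
lemma exists_basis_repr_eq {K V : Type*} {ι : Type u} [Field K] [AddCommGroup V] [Module K V]
    [FiniteDimensional K V] [Finite ι] (f : ι → Module.Dual K V)
    (hf : ∀ v, (∀ k, f k v = 0) → v = 0) :
    ∃ (κ : Type u) (_ : Fintype κ) (a : κ → ι) (b : Module.Basis κ K V),
      Function.Injective a ∧ ∀ v i, b.repr v i = f (a i) v := by
  obtain ⟨κ, a, ha, hspan, hli⟩ := exists_linearIndependent' K f
  have : Finite κ := Finite.of_injective a ha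
  have : Fintype κ := Fintype.ofFinite κ
  let L : V →ₗ[K] κ → K := LinearMap.pi (f ∘ a)
  have hker : LinearMap.ker L = ⊥ := by
    refine LinearMap.ker_eq_bot'.2 fun v hv => hf v fun k => ?_
    have hk : f k ∈ Submodule.span K (Set.range (f ∘ a)) := by
      rw [hspan]; exact Submodule.subset_span ⟨k, rfl⟩
    have hle : Submodule.span K (Set.range (f ∘ a)) ≤
        LinearMap.ker (Module.Dual.eval K V v) := by
      rw [Submodule.span_le]
      rintro _ ⟨i, rfl⟩
      exact congrFun hv i
    exact hle hk
  have hinj := LinearMap.ker_eq_bot.1 hker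
  have hdim : Module.finrank K V = Module.finrank K (κ → K) := by
    refine le_antisymm (LinearMap.finrank_le_finrank_of_injective hinj) ?_
    rw [Module.finrank_fintype_fun_eq_card, ← Subspace.dual_finrank_eq]
    exact hli.fintype_card_le_finrank
  exact ⟨κ, inferInstance, a, Module.Basis.ofEquivFun (LinearEquiv.ofInjectiveOfFinrankEq L hinj
    hdim), ha, fun v i => rfl⟩

section QuadraticComputation

variable {n m : ℕ}
  {μ η : Fin m →
    (Matrix (Fin n) (Fin n) (ZMod 2) × Matrix (Fin n) (Fin n) (ZMod 2) →ₗ[ZMod 2] ZMod 2)}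
  {α : Fin m → Fin n → Fin n → ZMod 2}

/-- The coefficient of the product gate `k` in the linear combination `C` of the outputs. -/
def outputForm {n m : ℕ} (α : Fin m → Fin n → Fin n → ZMod 2) (k : Fin m) :
    Module.Dual (ZMod 2) (Matrix (Fin n) (Fin n) (ZMod 2)) :=
  Matrix.traceLinearMap _ _ _ ∘ₗ
    LinearMap.mulLeft (ZMod 2) (Matrix.of (α k)).transpose

lemma trace_transpose_mul_eq_sum
    (h : ∀ x y : Matrix (Fin n) (Fin n) (ZMod 2), ∀ i j : Fin n,
      (x * y) i j = ∑ k : Fin m, α k i j * μ k (x, y) * η k (x, y))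
    (C x y : Matrix (Fin n) (Fin n) (ZMod 2)) :
    (C.transpose * (x * y)).trace = ∑ k, outputForm α k C * (μ k (x, y) * η k (x, y)) := by
  have hxy : x * y = ∑ k, (μ k (x, y) * η k (x, y)) • Matrix.of (α k) := by
    ext i j
    rw [h, Matrix.sum_apply]
    exact Finset.sum_congr rfl fun k _ => by simp; ring
  have htr (k : Fin m) : (C.transpose * Matrix.of (α k)).trace = outputForm α k C := by
    rw [← Matrix.trace_transpose]
    simp [outputForm, Matrix.transpose_mul]
  rw [hxy, Matrix.mul_sum, Matrix.trace_sum]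
  refine Finset.sum_congr rfl fun k _ => ?_
  rw [Matrix.mul_smul, Matrix.trace_smul, htr, smul_eq_mul, mul_comm]

lemma eq_zero_of_outputForm_eq_zero
    (h : ∀ x y : Matrix (Fin n) (Fin n) (ZMod 2), ∀ i j : Fin n,
      (x * y) i j = ∑ k : Fin m, α k i j * μ k (x, y) * η k (x, y))
    (C : Matrix (Fin n) (Fin n) (ZMod 2)) (hC : ∀ k, outputForm α k C = 0) : C = 0 := by
  rw [← Matrix.transpose_eq_zero, Matrix.ext_iff_trace_mul_right]
  intro x
  simpa [hC] using trace_transpose_mul_eq_sum h C x 1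

/-- A nonsingular linear combination of the outputs involves at least `n ^ 2` gates. -/
lemma sq_le_card_outputForm_ne_zero
    (h : ∀ x y : Matrix (Fin n) (Fin n) (ZMod 2), ∀ i j : Fin n,
      (x * y) i j = ∑ k : Fin m, α k i j * μ k (x, y) * η k (x, y))
    (C : Matrix (Fin n) (Fin n) (ZMod 2)) (hC : C.det ≠ 0) :
    n ^ 2 ≤ (Finset.univ.filter fun k => outputForm α k C ≠ 0).card := by
  by_contra! hlt
  set K := Finset.univ.filter fun k => outputForm α k C ≠ 0 with hK
  let L : (Matrix (Fin n) (Fin n) (ZMod 2) × Matrix (Fin n) (Fin n) (ZMod 2)) →ₗ[ZMod 2]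
      (K → ZMod 2) × (K → ZMod 2) :=
    (LinearMap.pi fun k : K => μ k).prod (LinearMap.pi fun k : K => η k)
  have hker : LinearMap.ker L ≠ ⊥ := by
    apply LinearMap.ker_ne_bot_of_finrank_lt
    simp only [Module.finrank_prod, Module.finrank_matrix, Module.finrank_fintype_fun_eq_card,
      Fintype.card_coe, Fintype.card_fin, Module.finrank_self]
    nlinarith
  obtain ⟨⟨x₀, y₀⟩, hmem, hne⟩ := Submodule.exists_mem_ne_zero_of_ne_bot hker
  have hL : (∀ k, outputForm α k C ≠ 0 → μ k (x₀, y₀) = 0) ∧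
      ∀ k, outputForm α k C ≠ 0 → η k (x₀, y₀) = 0 := by
    have h0 : L (x₀, y₀) = 0 := hmem
    exact ⟨fun k hk => congrFun (congrArg Prod.fst h0) ⟨k, by simpa [hK] using hk⟩,
      fun k hk => congrFun (congrArg Prod.snd h0) ⟨k, by simpa [hK] using hk⟩⟩
  have hshift (x y : Matrix (Fin n) (Fin n) (ZMod 2)) :
      (C.transpose * ((x₀ + x) * (y₀ + y))).trace = (C.transpose * (x * y)).trace := by
    rw [trace_transpose_mul_eq_sum h, trace_transpose_mul_eq_sum h]
    refine Finset.sum_congr rfl fun k _ => ?_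
    by_cases hk : outputForm α k C = 0
    · simp [hk]
    · rw [← Prod.mk_add_mk, map_add, map_add, hL.1 k hk, hL.2 k hk, zero_add, zero_add]
  have h00 : (C.transpose * (x₀ * y₀)).trace = 0 := by simpa using hshift 0 0
  have hunit : IsUnit C.transpose := by
    rw [Matrix.isUnit_iff_isUnit_det, Matrix.det_transpose]
    exact isUnit_iff_ne_zero.2 hC
  have hx : x₀ = 0 := by
    rw [← hunit.mul_right_eq_zero, Matrix.ext_iff_trace_mul_right]
    intro y
    have := hshift 0 y
    simp only [add_zero, mul_add, Matrix.trace_add, h00, zero_add, zero_mul, mul_zero,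
      Matrix.trace_zero] at this
    rw [zero_mul, Matrix.trace_zero, ← this, mul_assoc]
  have hy : y₀ = 0 := by
    rw [← hunit.mul_left_eq_zero, Matrix.ext_iff_trace_mul_right]
    intro x
    have := hshift x 0
    simp only [add_zero, add_mul, mul_add, Matrix.trace_add, h00, zero_add, mul_zero,
      Matrix.trace_zero] at this
    rw [zero_mul, Matrix.trace_zero, ← this, mul_assoc, Matrix.trace_mul_comm, mul_assoc]
  exact hne (by simp [hx, hy])

lemma two_mul_two_pow_sub_one_mul_sq_add_le {t : ℕ} (hn : n ≠ 0) (ht : t ≤ n)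
    (h : ∀ x y : Matrix (Fin n) (Fin n) (ZMod 2), ∀ i j : Fin n,
      (x * y) i j = ∑ k : Fin m, α k i j * μ k (x, y) * η k (x, y)) :
    2 * ((2 ^ t - 1) * n ^ 2) + 2 ^ t * n ^ 2 ≤ 2 ^ t * (m + 2 ^ t * n) := by
  classical
  obtain ⟨κ, _, a, b, ha, hb⟩ :=
    exists_basis_repr_eq (outputForm α) (eq_zero_of_outputForm_eq_zero h)
  obtain ⟨S, A, hS, hA, hAS⟩ := exists_sparse_family_det_ne_zero hn ht b
  have hκ : Fintype.card κ = n ^ 2 := by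
    rw [← Module.finrank_eq_card_basis b, Module.finrank_matrix]
    simp [sq]
  let f (k : Fin m) : (Fin t → ZMod 2) →ₗ[ZMod 2] ZMod 2 :=
    outputForm α k ∘ₗ Fintype.linearCombination (ZMod 2) A
  have hfapply (k : Fin m) (c : Fin t → ZMod 2) : f k c = outputForm α k (∑ j, c j • A j) := rfl
  let T := (Finset.univ \ S).image a
  have hT : T.card + S.card = n ^ 2 := by
    rw [Finset.card_image_of_injective _ ha, Finset.card_sdiff_add_card_eq_card S.subset_univ,
      Finset.card_univ, hκ]
  have hTc : Tᶜ.card + T.card = m := by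
    rw [Finset.card_compl_add_card, Fintype.card_fin]
  have hzero : ∀ k ∈ T, ∀ c, f k c = 0 := by
    intro k hk c
    obtain ⟨i, hi, rfl⟩ := Finset.mem_image.1 hk
    rw [hfapply, map_sum]
    refine Finset.sum_eq_zero fun j _ => ?_
    rw [map_smul, ← hb, hAS j i (by simpa using hi), smul_zero]
  have hlower : (2 ^ t - 1) * n ^ 2 ≤ ∑ c, (Finset.univ.filter fun k => f k c ≠ 0).card := by
    have hcard : (Finset.univ.erase (0 : Fin t → ZMod 2)).card = 2 ^ t - 1 := by
      rw [Finset.card_erase_of_mem (Finset.mem_univ _)]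
      simp
    rw [← hcard, ← smul_eq_mul]
    refine (Finset.card_nsmul_le_sum _ _ _ fun c hc => ?_).trans
      (Finset.sum_le_sum_of_subset (Finset.erase_subset _ _))
    exact sq_le_card_outputForm_ne_zero h _ (hA c (Finset.ne_of_mem_erase hc))
  have hswap : ∑ c, (Finset.univ.filter fun k => f k c ≠ 0).card =
      ∑ k, (Finset.univ.filter fun c => f k c ≠ 0).card := by
    simp only [Finset.card_filter]
    exact Finset.sum_comm
  have hupper : 2 * ∑ k, (Finset.univ.filter fun c => f k c ≠ 0).card ≤ Tᶜ.card * 2 ^ t := by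
    rw [← Finset.sum_subset (Finset.subset_univ Tᶜ) fun k _ hk => by
      simp [hzero k (by simpa using hk)], Finset.mul_sum, ← smul_eq_mul]
    exact Finset.sum_le_card_nsmul _ _ _ fun k _ => two_mul_card_ne_zero_le (f k)
  calc 2 * ((2 ^ t - 1) * n ^ 2) + 2 ^ t * n ^ 2
      ≤ Tᶜ.card * 2 ^ t + 2 ^ t * n ^ 2 := by omega
    _ = 2 ^ t * (m + S.card) := by
        rw [← hT]; linear_combination 2 ^ t * hTc
    _ ≤ 2 ^ t * (m + 2 ^ t * n) := by gcongr

end QuadraticComputation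


/-- Every quadratic computation of n×n matrix product over GF(2)
has length m ≥ 3n² − C·n^(5/3) for some absolute constant C > 0. -/
theorem quadratic_matrix_product_lower_bound_gf2 :
    ∃ C : ℝ, 0 < C ∧ ∀ n : ℕ, 1 ≤ n → ∀ m : ℕ,
      ∀ μ η : Fin m →
        (Matrix (Fin n) (Fin n) (ZMod 2) × Matrix (Fin n) (Fin n) (ZMod 2) →ₗ[ZMod 2] ZMod 2),
      ∀ α : Fin m → Fin n → Fin n → ZMod 2,
      (∀ x y : Matrix (Fin n) (Fin n) (ZMod 2), ∀ i j : Fin n,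
        (x * y) i j = ∑ k : Fin m, α k i j * μ k (x, y) * η k (x, y)) →
      (m : ℝ) ≥ 3 * (n : ℝ) ^ 2 - C * (n : ℝ) ^ ((5 : ℝ) / 3) := by
  refine ⟨5, by norm_num, fun n hn m μ η α h => ?_⟩
  set t := Nat.log 4 n with ht
  have hlo : 4 ^ t ≤ n := Nat.pow_log_le_self 4 (by omega)
  have hhi : n < 4 ^ (t + 1) := Nat.lt_pow_succ_log_self (by norm_num) n
  have key := two_mul_two_pow_sub_one_mul_sq_add_le (t := t) (by omega) (Nat.log_le_self 4 n) h
  set a : ℝ := 2 ^ t with ha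
  have ha1 : 1 ≤ a := one_le_pow₀ (by norm_num)
  have hsq : (4 : ℝ) ^ t = a ^ 2 := by rw [ha, ← pow_mul, mul_comm, pow_mul]; norm_num
  have hloR : a ^ 2 ≤ n := by rw [← hsq]; exact_mod_cast hlo
  have hhiR : (n : ℝ) ≤ (2 * a) ^ 2 := by
    have : (n : ℝ) ≤ 4 ^ (t + 1) := by exact_mod_cast hhi.le
    rw [pow_succ, hsq] at this
    linarith
  have keyR : 2 * ((a - 1) * n ^ 2) + a * n ^ 2 ≤ a * (m + a * n) := by
    have := (Nat.cast_le (α := ℝ)).2 key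
    push_cast [Nat.cast_sub (Nat.one_le_two_pow (n := t))] at this
    exact this
  have hn1 : (1 : ℝ) ≤ n := by exact_mod_cast hn
  have hs1 : a ≤ √n := Real.le_sqrt_of_sq_le hloR
  have hs2 : √n ≤ 2 * a := Real.sqrt_le_iff.2 ⟨by positivity, hhiR⟩
  have hpow : (n : ℝ) * √n ≤ (n : ℝ) ^ ((5 : ℝ) / 3) := by
    rw [Real.sqrt_eq_rpow, ← Real.rpow_one_add' (by positivity) (by norm_num)]
    exact Real.rpow_le_rpow_of_exponent_le hn1 (by norm_num)
  have hm : 3 * (n : ℝ) ^ 2 - 5 * (n * √n) ≤ m := by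
    have hss : √(n : ℝ) * √n = n := Real.mul_self_sqrt (by positivity)
    have h1 : (n : ℝ) ^ 2 ≤ 2 * a * (n * √n) := by
      calc (n : ℝ) ^ 2 = √n * (n * √n) := by linear_combination -(n : ℝ) * hss
        _ ≤ _ := by gcongr
    have h2 : a * (a * n) ≤ a * (n * √n) := by
      rw [mul_comm a (n : ℝ)]; gcongr
    refine le_of_mul_le_mul_left ?_ (by positivity : 0 < a)
    linarith
  linarith
end

section
/- Let p be a prime and let μ_1,…,μ_m, η_1,…,η_m and α^(k)_{i,j} form a bilinear computation of n×n matrix product over GF(p) of length m. Then for every matrix x ∈ M_n(GF(p)), the number of indices k ∈ {1,…,m} with μ_k(x) ≠ 0 is at least n·rank(x). -/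
/-- The matrices all of whose columns lie in the column space of `x`, parametrised by their
columns. -/
def columnsToMatrix {K : Type*} [Field K] {n : ℕ} (x : Matrix (Fin n) (Fin n) K) :
    (Fin n → LinearMap.range x.mulVecLin) →ₗ[K] (Fin n → Fin n → K) where
  toFun f i j := (f j : Fin n → K) i
  map_add' _ _ := rfl
  map_smul' _ _ := rfl

theorem columnsToMatrix_injective {K : Type*} [Field K] {n : ℕ}
    (x : Matrix (Fin n) (Fin n) K) : Function.Injective (columnsToMatrix x) := by
  intro f g h
  funext j
  ext i
  exact congrFun (congrFun h i) j

theorem exists_mul_eq_columnsToMatrix {K : Type*} [Field K] {n : ℕ}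
    (x : Matrix (Fin n) (Fin n) K) (f : Fin n → LinearMap.range x.mulVecLin) :
    ∃ y : Matrix (Fin n) (Fin n) K, ∀ i j, (x * y) i j = columnsToMatrix x f i j := by
  choose v hv using fun j => (f j).2
  exact ⟨Matrix.of fun i j => v j i, fun i j => congrFun (hv j) i⟩

/-- If all products `x * y` lie in a submodule, its dimension is at least `n * x.rank`. -/
theorem mul_rank_le_finrank_of_forall_mul_mem {K : Type*} [Field K] {n : ℕ}
    (x : Matrix (Fin n) (Fin n) K) (W : Submodule K (Fin n → Fin n → K))
    (hW : ∀ y : Matrix (Fin n) (Fin n) K, (fun i j => (x * y) i j) ∈ W) :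
    n * x.rank ≤ Module.finrank K W := by
  have hle : LinearMap.range (columnsToMatrix x) ≤ W := by
    rintro _ ⟨f, rfl⟩
    obtain ⟨y, hy⟩ := exists_mul_eq_columnsToMatrix x f
    simpa only [hy] using hW y
  calc
    n * x.rank = Module.finrank K (Fin n → LinearMap.range x.mulVecLin) := by
      simp [Module.finrank_pi_fintype, Matrix.rank]
    _ = Module.finrank K (LinearMap.range (columnsToMatrix x)) :=
      (LinearMap.finrank_range_of_inj (columnsToMatrix_injective x)).symm
    _ ≤ Module.finrank K W := Submodule.finrank_mono hle


/-- In a bilinear computation of n×n matrix product over GF(p),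
for every matrix x the number of indices k with μ_k(x) ≠ 0 is at least
n·rank(x). -/
theorem bilinear_computation_weight_lower_bound_gfp (p : ℕ) [Fact p.Prime] (n m : ℕ)
    (μ η : Fin m → (Matrix (Fin n) (Fin n) (ZMod p) →ₗ[ZMod p] ZMod p))
    (α : Fin m → Fin n → Fin n → ZMod p)
    (hcomp : ∀ x y : Matrix (Fin n) (Fin n) (ZMod p), ∀ i j : Fin n,
      (x * y) i j = ∑ k : Fin m, α k i j * μ k x * η k y) :
    ∀ x : Matrix (Fin n) (Fin n) (ZMod p),
      n * x.rank ≤ (Finset.univ.filter fun k => μ k x ≠ 0).card := by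
  classical
  intro x
  set S := Finset.univ.filter fun k => μ k x ≠ 0
  refine (mul_rank_le_finrank_of_forall_mul_mem x
    (Submodule.span (ZMod p) (S.image α : Set (Fin n → Fin n → ZMod p))) fun y => ?_).trans
      ((finrank_span_finset_le_card _).trans Finset.card_image_le)
  have hsum : (fun i j => (x * y) i j) = ∑ k, (μ k x * η k y) • α k := by
    funext i j
    simp only [hcomp, Finset.sum_apply, Pi.smul_apply, smul_eq_mul]
    exact Finset.sum_congr rfl fun k _ => by ring
  rw [hsum]
  refine Submodule.sum_mem _ fun k _ => ?_
  by_cases hk : μ k x = 0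
  · simp [hk]
  · exact Submodule.smul_mem _ _ (Submodule.subset_span
      (Finset.mem_coe.2 (Finset.mem_image_of_mem α (by simp [S, hk]))))
end
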